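/- arXiv:2104.01994 — 8 statements merged into one kernel-verified Lean document; each statement's English description precedes it below -/
import Mathlib

section
/- On the ladder representation, the Casimir operator acts as a scalar: the operator Q = A₊·A₋ − a₁·q⁻¹·k² − a₂·q·k⁻² satisfies Q·eₙ = (−a₁·q⁻¹·w² − a₂·q·w⁻²)·eₙ for every n ∈ ℕ; i.e. Q is the scalar −a₁·q^{2μ−1} − a₂·q^{1−2μ} (with w = q^μ) times the identity on V. -/
/-- The linear operator on `ℕ →₀ ℂ` sending the basis vector `eₙ` to `g n`. -/
noncomputable def ladderOp (g : ℕ → (ℕ →₀ ℂ)) : Module.End ℂ (ℕ →₀ ℂ) :=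
  Finsupp.lsum ℂ fun n => LinearMap.toSpanSingleton ℂ (ℕ →₀ ℂ) (g n)

theorem ladderOp_single (g : ℕ → (ℕ →₀ ℂ)) (n : ℕ) :
    ladderOp g (Finsupp.single n 1) = g n := by
  simp [ladderOp]

/-- On the ladder representation, the Casimir operator
`Q = A₊·A₋ − a₁·q⁻¹·k² − a₂·q·k⁻²` acts as the scalar
`−a₁·q⁻¹·w² − a₂·q·w⁻²` (i.e. `−a₁·q^{2μ−1} − a₂·q^{1−2μ}` with `w = q^μ`)
on every basis vector `eₙ`. -/
theorem casimir_scalar_on_ladder (q w : ℂ) (hq : q ≠ 0) (hq2 : q ^ 2 ≠ 1) (hw : w ≠ 0)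
    (a₂ a₁ : ℂ) (r : ℕ → ℂ) (hr0 : r 0 = 0)
    (hr : ∀ n : ℕ, (r n) ^ 2
      = (q ^ n - (q⁻¹) ^ n) * (a₁ * q ^ n * q⁻¹ * w ^ 2 - a₂ * q * (q⁻¹) ^ n * (w⁻¹) ^ 2))
    (k kinv Ap Am Q : Module.End ℂ (ℕ →₀ ℂ))
    (hk : k = ladderOp fun n => (q ^ n * w) • Finsupp.single n 1)
    (hkinv : kinv = ladderOp fun n => (q ^ n * w)⁻¹ • Finsupp.single n 1)
    (hAp : Ap = ladderOp fun n => r (n + 1) • Finsupp.single (n + 1) 1)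
    (hAm : Am = ladderOp fun n => if n = 0 then 0 else r n • Finsupp.single (n - 1) 1)
    (hQ : Q = Ap * Am - (a₁ * q⁻¹) • k ^ 2 - (a₂ * q) • kinv ^ 2) :
    ∀ n : ℕ, Q (Finsupp.single n 1)
      = (-(a₁ * q⁻¹ * w ^ 2) - a₂ * q * (w⁻¹) ^ 2) • Finsupp.single n 1 := by
  intro n
  have hAA : (Ap * Am) (Finsupp.single n 1) = (r n) ^ 2 • Finsupp.single n 1 := by
    subst hAp hAm
    cases n with
    | zero => simp only [Module.End.mul_apply, ladderOp_single, if_true, map_zero, hr0]; simp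
    | succ m =>
      simp only [Module.End.mul_apply, ladderOp_single, Nat.succ_ne_zero, if_false, map_smul,
        Nat.add_sub_cancel, smul_smul, sq]
  have hkk : (k ^ 2) (Finsupp.single n 1) = (q ^ n * w) ^ 2 • Finsupp.single n 1 := by
    simp only [hk, sq, Module.End.mul_apply, ladderOp_single, map_smul, smul_smul]
  have hkk' : (kinv ^ 2) (Finsupp.single n 1) = ((q ^ n * w)⁻¹) ^ 2 • Finsupp.single n 1 := by
    simp only [hkinv, sq, Module.End.mul_apply, ladderOp_single, map_smul, smul_smul]
  rw [hQ, LinearMap.sub_apply, LinearMap.sub_apply, LinearMap.smul_apply, LinearMap.smul_apply,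
    hAA, hkk, hkk', smul_smul, smul_smul, ← sub_smul, ← sub_smul, hr n]
  congr 1
  simp only [inv_pow]
  field_simp
  ring
end

section
/- Addition rule for sl_q(2): given a mutually commuting pair consisting of an (a₂,d)-triple (k_A, A₊, A₋) and a (d,b₁)-triple (k_B, B₊, B₋), the elements k_C = k_A·k_B, C₊ = A₊·k_B⁻¹ + B₊·k_A, C₋ = A₋·k_B⁻¹ + B₋·k_A form an (a₂,b₁)-triple; that is, k_C is invertible, k_C·C₊ = q·C₊·k_C, k_C·C₋ = q⁻¹·C₋·k_C, and C₋·C₊ − C₊·C₋ = (q − q⁻¹)·(b₁·k_C² − a₂·k_C⁻²). Symbolically, (a₂,d) ⊕ (d,b₁) = (a₂,b₁). -/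
/-- If `k` `c`-commutes with `x`, then its inverse `c⁻¹`-commutes with `x`. -/
theorem inv_mul_eq_inv_smul_mul_inv {K R : Type*} [Field K] [Ring R] [Algebra K R]
    {c : K} (hc : c ≠ 0) {k kinv x : R} (hk : k * kinv = 1) (hk' : kinv * k = 1)
    (h : k * x = c • (x * k)) : kinv * x = c⁻¹ • (x * kinv) := by
  have hx : x * kinv = c • (kinv * x) := by
    calc x * kinv = kinv * (k * x) * kinv := by rw [← mul_assoc, hk', one_mul]
      _ = c • (kinv * x * (k * kinv)) := by
        rw [h]; simp only [mul_smul_comm, smul_mul_assoc, mul_assoc]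
      _ = c • (kinv * x) := by rw [hk, mul_one]
  rw [hx, inv_smul_smul₀ hc]

theorem addition_rule_slq2 {R : Type*} [Ring R] [Algebra ℂ R]
    (q : ℂ) (hq : q ≠ 0) (hq2 : q ^ 2 ≠ 1)
    (a₂ d b₁ : ℂ)
    (kA kAinv Ap Am kB kBinv Bp Bm : R)
    (hkA : kA * kAinv = 1) (hkA' : kAinv * kA = 1)
    (hkB : kB * kBinv = 1) (hkB' : kBinv * kB = 1)
    (hA1 : kA * Ap = q • (Ap * kA))
    (hA2 : kA * Am = q⁻¹ • (Am * kA))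
    (hA3 : Am * Ap - Ap * Am = (q - q⁻¹) • (d • kA ^ 2 - a₂ • kAinv ^ 2))
    (hB1 : kB * Bp = q • (Bp * kB))
    (hB2 : kB * Bm = q⁻¹ • (Bm * kB))
    (hB3 : Bm * Bp - Bp * Bm = (q - q⁻¹) • (b₁ • kB ^ 2 - d • kBinv ^ 2))
    (hcomm : ∀ x ∈ ({kA, kAinv, Ap, Am} : Set R),
             ∀ y ∈ ({kB, kBinv, Bp, Bm} : Set R), Commute x y)
    :
    ((kA * kB) * (kAinv * kBinv) = 1 ∧ (kAinv * kBinv) * (kA * kB) = 1) ∧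
    (kA * kB) * (Ap * kBinv + Bp * kA) = q • ((Ap * kBinv + Bp * kA) * (kA * kB)) ∧
    (kA * kB) * (Am * kBinv + Bm * kA) = q⁻¹ • ((Am * kBinv + Bm * kA) * (kA * kB)) ∧
    (Am * kBinv + Bm * kA) * (Ap * kBinv + Bp * kA)
        - (Ap * kBinv + Bp * kA) * (Am * kBinv + Bm * kA)
      = (q - q⁻¹) • (b₁ • (kA * kB) ^ 2 - a₂ • (kAinv * kBinv) ^ 2) := by
  have hB1inv : kBinv * Bp = q⁻¹ • (Bp * kBinv) :=
    inv_mul_eq_inv_smul_mul_inv hq hkB hkB' hB1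
  have hB2inv : kBinv * Bm = q • (Bm * kBinv) := by
    simpa using inv_mul_eq_inv_smul_mul_inv (inv_ne_zero hq) hkB hkB' hB2
  have left_mul {x y z : R} (h : x * y = z) (w : R) : x * (y * w) = z * w := by
    rw [← mul_assoc, h]
  simp only [Set.mem_insert_iff, Set.mem_singleton_iff, forall_eq_or_imp, forall_eq] at hcomm
  obtain ⟨⟨kA_kB, kA_kBinv, kA_Bp, kA_Bm⟩, ⟨kAinv_kB, kAinv_kBinv, -, -⟩,
    ⟨Ap_kB, Ap_kBinv, -, Ap_Bm⟩, Am_kB, Am_kBinv, Am_Bp, -⟩ := hcomm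
  -- In the last three parts, `simp` moves the `A`-letters to the left of the `B`-letters.
  refine ⟨⟨?_, ?_⟩, ?_, ?_, ?_⟩
  · rw [kAinv_kB.symm.mul_mul_mul_comm, hkA, hkB, mul_one]
  · rw [kA_kBinv.symm.mul_mul_mul_comm, hkA', hkB', mul_one]
  · simp only [mul_add, add_mul, mul_assoc, kA_Bp.symm.eq, kA_kB.symm.left_comm,
      kA_kBinv.symm.left_comm, kA_Bp.symm.left_comm, Ap_kB.symm.left_comm, hkB, hkB',
      hB1, hA1, mul_smul_comm, smul_add, mul_one]
  · simp only [mul_add, add_mul, mul_assoc, kA_Bm.symm.eq, kA_kB.symm.left_comm,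
      kA_kBinv.symm.left_comm, kA_Bm.symm.left_comm, Am_kB.symm.left_comm, hkB, hkB',
      hB2, hA2, mul_smul_comm, smul_add, mul_one]
  · rw [sub_eq_iff_eq_add] at hA3 hB3
    simp only [pow_two] at hA3 hB3 ⊢
    simp only [mul_add, add_mul, mul_sub, sub_mul, mul_assoc, kA_Bp.symm.eq, kA_Bm.symm.eq,
      kA_kB.symm.left_comm, kA_kBinv.symm.left_comm, kA_Bp.symm.left_comm,
      kA_Bm.symm.left_comm, kAinv_kBinv.symm.left_comm, Ap_kBinv.symm.left_comm,
      Ap_Bm.symm.left_comm, Am_kBinv.symm.left_comm, Am_Bp.symm.left_comm,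
      hB1inv, hB2inv, left_mul hA1, left_mul hA2, hB3, left_mul hA3,
      mul_smul_comm, smul_mul_assoc]
    module
end

section
/- For every integer m, setting L = (k_A·k_B⁻¹)^m (playing the role of q^{mΔ}) and P₂ = p₂·(k_A·k_B⁻¹)² + p₁·(k_A·k_B⁻¹), one has the identity L²·K₂ + K₂·L² = (q^{2m} + q^{−2m})·L·K₂·L − (q^m − q^{−m})²·P₂·L². -/
/-- If a unit `u` commutes with `x` up to a nonzero scalar `c`, then `u ^ m` commutes with `x`
up to `c ^ m`. -/
theorem units_zpow_mul_eq_smul {R : Type*} [Ring R] [Algebra ℂ R] {c : ℂ} (hc : c ≠ 0)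
    (u : Rˣ) {x : R} (h : (u : R) * x = c • (x * u)) (m : ℤ) :
    ((u ^ m : Rˣ) : R) * x = c ^ m • (x * ((u ^ m : Rˣ) : R)) := by
  let v : Rˣ := Units.map (algebraMap ℂ R : ℂ →* R) (Units.mk0 c hc)
  have hvu : Commute v u := Units.ext (Algebra.commutes c (u : R))
  have hs : SemiconjBy x ((v * u : Rˣ) : R) (u : R) := by
    simp [SemiconjBy, v, h, ← Algebra.smul_def]
  have hm := (hs.units_zpow_right m).eq
  rw [hvu.mul_zpow, ← map_zpow] at hm
  have hv : ((Units.map (algebraMap ℂ R : ℂ →* R) (Units.mk0 c hc ^ m) : Rˣ) : R)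
      = algebraMap ℂ R (c ^ m) := by
    rw [Units.coe_map, Units.val_zpow_eq_zpow_val]
    rfl
  rw [← hm, Units.val_mul, hv, ← Algebra.smul_def, mul_smul_comm]

/-- An element commuting with `L` up to the scalar `c` satisfies the homogeneous part of the
quadratic relation. -/
theorem sq_mul_add_mul_sq_of_mul_eq_smul {R : Type*} [Ring R] [Algebra ℂ R] {c : ℂ} (hc : c ≠ 0)
    {L x : R} (h : L * x = c • (x * L)) :
    L ^ 2 * x + x * L ^ 2 = (c + c⁻¹) • (L * x * L) := by
  have h2 : L ^ 2 * x = (c * c) • (x * L ^ 2) := by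
    rw [pow_two, mul_assoc, h, mul_smul_comm, ← mul_assoc, h, smul_mul_assoc, smul_smul, mul_assoc]
  rw [h2, h, smul_mul_assoc, smul_smul, add_mul, inv_mul_cancel₀ hc, add_smul, one_smul,
    mul_assoc x, ← pow_two L]

/-- Scalar commutation relations multiply. -/
theorem mul_mul_eq_smul_of_mul_eq_smul {R : Type*} [Ring R] [Algebra ℂ R] {c c' : ℂ}
    {u x y : R} (hx : u * x = c • (x * u)) (hy : u * y = c' • (y * u)) :
    u * (x * y) = (c * c') • (x * y * u) := by
  rw [← mul_assoc, hx, smul_mul_assoc, mul_assoc, hy, mul_smul_comm, smul_smul, mul_assoc]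

/-- A scalar commutation relation with an invertible element, transported to its inverse. -/
theorem inv_mul_eq_smul_of_mul_eq_smul {R : Type*} [Ring R] [Algebra ℂ R] {c : ℂ} (hc : c ≠ 0)
    {k k' x : R} (hk : k * k' = 1) (hk' : k' * k = 1) (h : k * x = c • (x * k)) :
    k' * x = c⁻¹ • (x * k') := by
  have h' : x * k' = c • (k' * x) := by
    calc x * k' = k' * (k * x) * k' := by rw [← mul_assoc, hk', one_mul]
      _ = c • (k' * x) := by
        rw [h, mul_smul_comm, smul_mul_assoc, mul_assoc, mul_assoc x, hk, mul_one]
  rw [h', smul_smul, inv_mul_cancel₀ hc, one_smul]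

theorem qpower_identity {R : Type*} [Ring R] [Algebra ℂ R]
    (q : ℂ) (hq : q ≠ 0) (hq2 : q ^ 2 ≠ 1)
    (a₂ d b₁ : ℂ)
    (kA kAinv Ap Am kB kBinv Bp Bm : R)
    (hkA : kA * kAinv = 1) (hkA' : kAinv * kA = 1)
    (hkB : kB * kBinv = 1) (hkB' : kBinv * kB = 1)
    (hA1 : kA * Ap = q • (Ap * kA))
    (hA2 : kA * Am = q⁻¹ • (Am * kA))
    (hA3 : Am * Ap - Ap * Am = (q - q⁻¹) • (d • kA ^ 2 - a₂ • kAinv ^ 2))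
    (hB1 : kB * Bp = q • (Bp * kB))
    (hB2 : kB * Bm = q⁻¹ • (Bm * kB))
    (hB3 : Bm * Bp - Bp * Bm = (q - q⁻¹) • (b₁ • kB ^ 2 - d • kBinv ^ 2))
    (hcomm : ∀ x ∈ ({kA, kAinv, Ap, Am} : Set R),
             ∀ y ∈ ({kB, kBinv, Bp, Bm} : Set R), Commute x y)
    (QA QB : R)
    (hQA : QA = Ap * Am - (d * q⁻¹) • kA ^ 2 - (a₂ * q) • kAinv ^ 2)
    (hQB : QB = Bp * Bm - (b₁ * q⁻¹) • kB ^ 2 - (d * q) • kBinv ^ 2)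
    (K₁ K₂ : R)
    (hK1 : K₁ = kAinv * kB)
    (hK2 : K₂ = (Ap * kBinv + Bp * kA) * (Am * kBinv + Bm * kA)
      - (b₁ * q⁻¹) • (kA * kB) ^ 2 - (a₂ * q) • (kAinv * kBinv) ^ 2)
    (p₂ : ℂ) (hp2 : p₂ = (q + q⁻¹) * d)
    (p₁ : R) (hp1 : p₁ = QB * (kA * kB) + QA * (kAinv * kBinv))
    (u : Rˣ) (hu : (u : R) = kA * kBinv)
    (m : ℤ) (L P₂ : R)
    (hL : L = ((u ^ m : Rˣ) : R))
    (hP2 : P₂ = p₂ • (kA * kBinv) ^ 2 + p₁ * (kA * kBinv)) :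
    L ^ 2 * K₂ + K₂ * L ^ 2
      = (q ^ (2 * m) + q ^ (-(2 * m))) • (L * K₂ * L)
        - ((q ^ m - q ^ (-m)) ^ 2) • (P₂ * L ^ 2) := by
  have hAB : ∀ x ∈ ({kA, kAinv, Ap, Am} : Set R), ∀ y ∈ ({kB, kBinv, Bp, Bm} : Set R),
      x * y = y * x := fun x hx y hy => (hcomm x hx y hy).eq
  simp only [Set.mem_insert_iff, Set.mem_singleton_iff, forall_eq_or_imp, forall_eq] at hAB
  obtain ⟨⟨kA_kB, kA_kBi, kA_Bp, kA_Bm⟩, ⟨kAi_kB, kAi_kBi, kAi_Bp, kAi_Bm⟩,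
    ⟨Ap_kB, Ap_kBi, Ap_Bp, Ap_Bm⟩, ⟨Am_kB, Am_kBi, Am_Bp, Am_Bm⟩⟩ := hAB
  have hqi : q⁻¹ ≠ 0 := inv_ne_zero hq
  have hB1' := inv_mul_eq_smul_of_mul_eq_smul hq hkB hkB' hB1
  have hB2' := inv_mul_eq_smul_of_mul_eq_smul hqi hkB hkB' hB2
  rw [inv_inv] at hB2'
  have huAp : (u : R) * Ap = q • (Ap * u) := by
    rw [hu, mul_assoc, ← Ap_kBi, ← mul_assoc, hA1, smul_mul_assoc, mul_assoc]
  have huAm : (u : R) * Am = q⁻¹ • (Am * u) := by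
    rw [hu, mul_assoc, ← Am_kBi, ← mul_assoc, hA2, smul_mul_assoc, mul_assoc]
  have huBp : (u : R) * Bp = q⁻¹ • (Bp * u) := by
    rw [hu, mul_assoc, hB1', mul_smul_comm, ← mul_assoc, kA_Bp, mul_assoc]
  have huBm : (u : R) * Bm = q • (Bm * u) := by
    rw [hu, mul_assoc, hB2', mul_smul_comm, ← mul_assoc, kA_Bm, mul_assoc]
  have huA : (u : R) * kA = (1 : ℂ) • (kA * u) := by
    rw [hu, one_smul, mul_assoc, ← kA_kBi]
  have huB : (u : R) * kBinv = (1 : ℂ) • (kBinv * u) := by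
    rw [hu, one_smul, ← mul_assoc, ← kA_kBi]
  have huAi : (u : R) * kAinv = (1 : ℂ) • (kAinv * u) := by
    rw [hu, one_smul, mul_assoc, ← kAi_kBi, ← mul_assoc, ← mul_assoc, hkA, hkA']
  have huB' : (u : R) * kB = (1 : ℂ) • (kB * u) := by
    rw [hu, one_smul, mul_assoc, hkB', ← mul_assoc, ← kA_kB, mul_assoc, hkB]
  -- The parts of `K₂` of weight `q ^ 2` and `q ^ (-2)`; the remaining part is `P₂`.
  obtain ⟨X, hX⟩ : ∃ X, X = Ap * kBinv * (Bm * kA) := ⟨_, rfl⟩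
  obtain ⟨Y, hY⟩ : ∃ Y, Y = Bp * kA * (Am * kBinv) := ⟨_, rfl⟩
  have huX : (u : R) * X = (q ^ 2) • (X * u) := by
    rw [hX, mul_mul_eq_smul_of_mul_eq_smul (mul_mul_eq_smul_of_mul_eq_smul huAp huB)
      (mul_mul_eq_smul_of_mul_eq_smul huBm huA)]
    simp [pow_two]
  have huY : (u : R) * Y = ((q ^ 2)⁻¹) • (Y * u) := by
    rw [hY, mul_mul_eq_smul_of_mul_eq_smul (mul_mul_eq_smul_of_mul_eq_smul huBp huA)
      (mul_mul_eq_smul_of_mul_eq_smul huAm huB)]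
    simp [pow_two]
  have hAA : Ap * kBinv * (Am * kBinv) = Ap * Am * kBinv ^ 2 := by
    rw [mul_assoc, ← mul_assoc kBinv, ← Am_kBi, pow_two]
    simp only [mul_assoc]
  have hBB : Bp * kA * (Bm * kA) = Bp * Bm * kA ^ 2 := by
    rw [mul_assoc, ← mul_assoc kA, kA_Bm, pow_two]
    simp only [mul_assoc]
  have hkk : (kA * kB) * (kA * kBinv) = kA ^ 2 := by
    rw [kA_kBi, mul_assoc, ← mul_assoc kB, hkB, one_mul, pow_two]
  have hkk' : (kAinv * kBinv) * (kA * kBinv) = kBinv ^ 2 := by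
    rw [kAi_kBi, mul_assoc, ← mul_assoc kAinv, hkA', one_mul, pow_two]
  have hABsq : (kA * kB) ^ 2 = kB ^ 2 * kA ^ 2 := by
    rw [kA_kB, Commute.mul_pow (show Commute kB kA from kA_kB.symm)]
  have hABisq : (kAinv * kBinv) ^ 2 = kAinv ^ 2 * kBinv ^ 2 :=
    Commute.mul_pow (show Commute kAinv kBinv from kAi_kBi) 2
  have hmix : (kA * kBinv) ^ 2 = kA ^ 2 * kBinv ^ 2 :=
    Commute.mul_pow (show Commute kA kBinv from kA_kBi) 2
  have hmix' : kBinv ^ 2 * kA ^ 2 = kA ^ 2 * kBinv ^ 2 :=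
    (Commute.pow_pow (show Commute kA kBinv from kA_kBi) 2 2).eq.symm
  have hK : K₂ = X + Y + P₂ := by
    rw [hK2, hP2, hp1, add_mul (QB * _), mul_assoc QB, mul_assoc QA, hkk, hkk', hQA, hQB, hp2,
      add_mul, mul_add, mul_add, hAA, hBB, ← hX, ← hY, hABsq, hABisq, hmix]
    simp only [sub_mul, smul_mul_assoc, hmix']
    module
  have huP : (u : R) * P₂ = (1 : ℂ) • (P₂ * u) := by
    have cA : Commute (u : R) kA := by simpa [commute_iff_eq] using huA
    have cAi : Commute (u : R) kAinv := by simpa [commute_iff_eq] using huAi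
    have cB : Commute (u : R) kB := by simpa [commute_iff_eq] using huB'
    have cBi : Commute (u : R) kBinv := by simpa [commute_iff_eq] using huB
    have cAA : Commute (u : R) (Ap * Am) := by
      simpa [hq, commute_iff_eq] using mul_mul_eq_smul_of_mul_eq_smul huAp huAm
    have cBB : Commute (u : R) (Bp * Bm) := by
      simpa [hq, commute_iff_eq] using mul_mul_eq_smul_of_mul_eq_smul huBp huBm
    have cQA : Commute (u : R) QA := by
      rw [hQA]
      exact (cAA.sub_right ((cA.pow_right 2).smul_right _)).sub_right
        ((cAi.pow_right 2).smul_right _)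
    have cQB : Commute (u : R) QB := by
      rw [hQB]
      exact (cBB.sub_right ((cB.pow_right 2).smul_right _)).sub_right
        ((cBi.pow_right 2).smul_right _)
    rw [one_smul, hP2, hp1]
    exact ((((cA.mul_right cBi).pow_right 2).smul_right _).add_right
      (((cQB.mul_right (cA.mul_right cB)).add_right
        (cQA.mul_right (cAi.mul_right cBi))).mul_right (cA.mul_right cBi))).eq
  have hq2' : q ^ 2 ≠ 0 := pow_ne_zero 2 hq
  have hLX := units_zpow_mul_eq_smul hq2' u huX m
  have hLY := units_zpow_mul_eq_smul (inv_ne_zero hq2') u huY m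
  have hLP := units_zpow_mul_eq_smul one_ne_zero u huP m
  rw [← hL] at hLX hLY hLP
  rw [one_zpow, one_smul] at hLP
  have eX := sq_mul_add_mul_sq_of_mul_eq_smul (zpow_ne_zero m hq2') hLX
  have eY := sq_mul_add_mul_sq_of_mul_eq_smul (zpow_ne_zero m (inv_ne_zero hq2')) hLY
  have hLP2 : L ^ 2 * P₂ = P₂ * L ^ 2 := (Commute.pow_left (show Commute L P₂ from hLP) 2).eq
  have hLPL : L * P₂ * L = P₂ * L ^ 2 := by rw [hLP, mul_assoc, pow_two]
  have hpow : (q ^ 2) ^ m = q ^ (2 * m) := by rw [zpow_mul]; norm_cast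
  have hsq : (q ^ m - q ^ (-m)) ^ 2 = q ^ (2 * m) + q ^ (-(2 * m)) - 2 := by
    have h1 : q ^ m ≠ 0 := zpow_ne_zero m hq
    rw [zpow_neg, zpow_neg, mul_comm 2 m, zpow_mul]
    norm_cast
    field_simp
    ring
  rw [inv_zpow, inv_inv, hpow, ← zpow_neg, add_comm (q ^ (-(2 * m)))] at eY
  rw [hpow, ← zpow_neg] at eX
  calc L ^ 2 * K₂ + K₂ * L ^ 2
      = (L ^ 2 * X + X * L ^ 2) + (L ^ 2 * Y + Y * L ^ 2) + (L ^ 2 * P₂ + P₂ * L ^ 2) := by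
        rw [hK]; noncomm_ring
    _ = _ := by
        rw [eX, eY, hLP2, hsq, hK, mul_add, mul_add, add_mul, add_mul, hLPL]
        module
end

section
/- First quadratic relation of the hidden symmetry algebra: the symmetry operators K₁ and K₂ satisfy K₁²·K₂ + K₂·K₁² − (q² + q⁻²)·K₁·K₂·K₁ + (q − q⁻¹)²·(p₂·1 + p₁·K₁) = 0. -/
/-- If `k` has the two-sided inverse `l` and commutes with `x` up to
the scalar `c`, then `l` commutes with `x` up to `c⁻¹`. -/
theorem inverse_mul_eq_smul {R : Type*} [Ring R] [Algebra ℂ R] {c : ℂ} (hc : c ≠ 0) {k l x : R}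
    (hkl : k * l = 1) (hlk : l * k = 1) (h : k * x = c • (x * k)) :
    l * x = c⁻¹ • (x * l) := by
  have h' : x * l = c • (l * x) := by
    calc x * l = l * (k * x) * l := by rw [← mul_assoc, hlk, one_mul]
      _ = c • (l * x) := by
        rw [h, mul_smul_comm, smul_mul_assoc, mul_assoc, mul_assoc, hkl, mul_one]
  rw [h', smul_smul, inv_mul_cancel₀ hc, one_smul]

/-- If `K * X = c • (X * K)` and `c` is a root of `t ^ 2 - s * t + 1`, then `X` is annihilated by
the quadratic operator `X ↦ K² X + X K² - s K X K`. -/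
theorem quadratic_eq_zero {R : Type*} [Ring R] [Algebra ℂ R] {c s : ℂ} {K X : R}
    (h : K * X = c • (X * K)) (hc : c ^ 2 + 1 = s * c) :
    K ^ 2 * X + X * K ^ 2 - s • (K * X * K) = 0 := by
  have h2 : K ^ 2 * X = c ^ 2 • (X * K ^ 2) := by
    rw [pow_two K, mul_assoc, h, mul_smul_comm, ← mul_assoc, h, smul_mul_assoc, smul_smul,
      mul_assoc, pow_two c]
  rw [h2, h, smul_mul_assoc, mul_assoc, ← pow_two, smul_smul, ← hc]
  module

/-- On an element `D` commuting with `K`, the quadratic operator `X ↦ K² X + X K² - s K X K` is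
multiplication by `(2 - s) K²`. -/
theorem quadratic_of_commute {R : Type*} [Ring R] [Algebra ℂ R] (s : ℂ) {K D : R}
    (h : Commute K D) :
    K ^ 2 * D + D * K ^ 2 - s • (K * D * K) = (2 - s) • (D * K ^ 2) := by
  rw [(h.pow_left 2).eq, h.eq, mul_assoc, ← pow_two]
  module

/-- If `k` commutes with `x` and `y` up to scalars, it commutes with `x * y` up to their product. -/
theorem mul_mul_eq_smul {R : Type*} [Ring R] [Algebra ℂ R] {c e : ℂ} {k x y : R}
    (hx : k * x = c • (x * k)) (hy : k * y = e • (y * k)) :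
    k * (x * y) = (c * e) • (x * y * k) := by
  rw [← mul_assoc, hx, smul_mul_assoc, mul_assoc, hy, mul_smul_comm, smul_smul, mul_assoc]

/-- If `k` and `l` commute with `x` up to scalars, `k * l` commutes with `x` up to their product. -/
theorem mul_mul_eq_smul_left {R : Type*} [Ring R] [Algebra ℂ R] {c e : ℂ} {k l x : R}
    (hk : k * x = c • (x * k)) (hl : l * x = e • (x * l)) :
    k * l * x = (c * e) • (x * (k * l)) := by
  rw [mul_assoc, hl, mul_smul_comm, ← mul_assoc, hk, smul_mul_assoc, smul_smul, mul_assoc,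
    mul_comm e]

theorem first_AW_relation {R : Type*} [Ring R] [Algebra ℂ R]
    (q : ℂ) (hq : q ≠ 0) (hq2 : q ^ 2 ≠ 1)
    (a₂ d b₁ : ℂ)
    (kA kAinv Ap Am kB kBinv Bp Bm : R)
    (hkA : kA * kAinv = 1) (hkA' : kAinv * kA = 1)
    (hkB : kB * kBinv = 1) (hkB' : kBinv * kB = 1)
    (hA1 : kA * Ap = q • (Ap * kA))
    (hA2 : kA * Am = q⁻¹ • (Am * kA))
    (hA3 : Am * Ap - Ap * Am = (q - q⁻¹) • (d • kA ^ 2 - a₂ • kAinv ^ 2))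
    (hB1 : kB * Bp = q • (Bp * kB))
    (hB2 : kB * Bm = q⁻¹ • (Bm * kB))
    (hB3 : Bm * Bp - Bp * Bm = (q - q⁻¹) • (b₁ • kB ^ 2 - d • kBinv ^ 2))
    (hcomm : ∀ x ∈ ({kA, kAinv, Ap, Am} : Set R),
             ∀ y ∈ ({kB, kBinv, Bp, Bm} : Set R), Commute x y)
    (QA QB : R)
    (hQA : QA = Ap * Am - (d * q⁻¹) • kA ^ 2 - (a₂ * q) • kAinv ^ 2)
    (hQB : QB = Bp * Bm - (b₁ * q⁻¹) • kB ^ 2 - (d * q) • kBinv ^ 2)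
    (K₁ K₂ : R)
    (hK1 : K₁ = kAinv * kB)
    (hK2 : K₂ = (Ap * kBinv + Bp * kA) * (Am * kBinv + Bm * kA)
      - (b₁ * q⁻¹) • (kA * kB) ^ 2 - (a₂ * q) • (kAinv * kBinv) ^ 2)
    (p₂ : ℂ) (hp2 : p₂ = (q + q⁻¹) * d)
    (p₁ : R) (hp1 : p₁ = QB * (kA * kB) + QA * (kAinv * kBinv))
    :
    K₁ ^ 2 * K₂ + K₂ * K₁ ^ 2 - (q ^ 2 + (q⁻¹) ^ 2) • (K₁ * K₂ * K₁)
      + ((q - q⁻¹) ^ 2) • (p₂ • (1 : R) + p₁ * K₁) = 0 := by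
  have comm {x y : R} (hx : x ∈ ({kA, kAinv, Ap, Am} : Set R))
      (hy : y ∈ ({kB, kBinv, Bp, Bm} : Set R)) : Commute x y := hcomm x hx y hy
  have one_smul_of {x y : R} (h : Commute x y) : x * y = (1 : ℂ) • (y * x) := by
    rw [one_smul, h.eq]
  have hqi : q⁻¹ ≠ 0 := inv_ne_zero hq
  have cAA : Commute kA kAinv := hkA.trans hkA'.symm
  have cBB : Commute kB kBinv := hkB.trans hkB'.symm
  have cAB : Commute kA kB := comm (by simp) (by simp)
  have caB : Commute kAinv kB := comm (by simp) (by simp)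
  have cab : Commute kAinv kBinv := comm (by simp) (by simp)
  have KAp : K₁ * Ap = q⁻¹ • (Ap * K₁) := by
    rw [hK1, mul_mul_eq_smul_left (inverse_mul_eq_smul hq hkA hkA' hA1)
      (one_smul_of (comm (by simp) (by simp)).symm), mul_one]
  have KAm : K₁ * Am = q • (Am * K₁) := by
    rw [hK1, mul_mul_eq_smul_left (inverse_mul_eq_smul hqi hkA hkA' hA2)
      (one_smul_of (comm (by simp) (by simp)).symm), mul_one, inv_inv]
  have KBp : K₁ * Bp = q • (Bp * K₁) := by
    rw [hK1, mul_mul_eq_smul_left (one_smul_of (comm (by simp) (by simp))) hB1, one_mul]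
  have KBm : K₁ * Bm = q⁻¹ • (Bm * K₁) := by
    rw [hK1, mul_mul_eq_smul_left (one_smul_of (comm (by simp) (by simp))) hB2, one_mul]
  have KkA : Commute K₁ kA := hK1 ▸ cAA.symm.mul_left cAB.symm
  have KkAinv : Commute K₁ kAinv := hK1 ▸ (Commute.refl kAinv).mul_left caB.symm
  have KkB : Commute K₁ kB := hK1 ▸ caB.mul_left (Commute.refl kB)
  have KkBinv : Commute K₁ kBinv := hK1 ▸ cab.mul_left cBB
  have KA : Commute K₁ (Ap * Am) := by
    have h := mul_mul_eq_smul KAp KAm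
    rwa [inv_mul_cancel₀ hq, one_smul] at h
  have KB : Commute K₁ (Bp * Bm) := by
    have h := mul_mul_eq_smul KBp KBm
    rwa [mul_inv_cancel₀ hq, one_smul] at h
  set D : R := Ap * Am * kBinv ^ 2 + Bp * Bm * kA ^ 2
    - (b₁ * q⁻¹) • (kA * kB) ^ 2 - (a₂ * q) • (kAinv * kBinv) ^ 2 with hD
  set X : R := Ap * kBinv * (Bm * kA) with hX
  set Y : R := Bp * kA * (Am * kBinv) with hY
  have hK2' : K₂ = D + X + Y := by
    have eA : Ap * kBinv * (Am * kBinv) = Ap * Am * kBinv ^ 2 := by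
      have h : Commute Am kBinv := comm (by simp) (by simp)
      rw [mul_assoc, ← mul_assoc kBinv, ← h.eq, pow_two]
      simp only [mul_assoc]
    have eB : Bp * kA * (Bm * kA) = Bp * Bm * kA ^ 2 := by
      have h : Commute kA Bm := comm (by simp) (by simp)
      rw [mul_assoc, ← mul_assoc kA, h.eq, pow_two]
      simp only [mul_assoc]
    rw [hK2, hD, hX, hY, ← eA, ← eB]
    noncomm_ring
  have hDcomm : Commute K₁ D :=
    (((KA.mul_right (KkBinv.pow_right 2)).add_right (KB.mul_right (KkA.pow_right 2))).sub_right
      (((KkA.mul_right KkB).pow_right 2).smul_right _)).sub_right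
      (((KkAinv.mul_right KkBinv).pow_right 2).smul_right _)
  have hXK := quadratic_eq_zero (s := q ^ 2 + q⁻¹ ^ 2)
    (mul_mul_eq_smul (mul_mul_eq_smul KAp (one_smul_of KkBinv))
      (mul_mul_eq_smul KBm (one_smul_of KkA))) (by field_simp; ring)
  have hYK := quadratic_eq_zero (s := q ^ 2 + q⁻¹ ^ 2)
    (mul_mul_eq_smul (mul_mul_eq_smul KBp (one_smul_of KkA))
      (mul_mul_eq_smul KAm (one_smul_of KkBinv))) (by field_simp)
  have hDK := quadratic_of_commute (q ^ 2 + q⁻¹ ^ 2) hDcomm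
  have hkAA : kA ^ 2 * kAinv ^ 2 = 1 := by rw [← cAA.mul_pow, hkA, one_pow]
  have hkBB : kBinv ^ 2 * kB ^ 2 = 1 := by rw [← cBB.symm.mul_pow, hkB', one_pow]
  have hKsq : K₁ ^ 2 = kAinv ^ 2 * kB ^ 2 := by rw [hK1, caB.mul_pow]
  have eA : kBinv ^ 2 * K₁ ^ 2 = kAinv ^ 2 := by
    rw [hKsq, (caB.pow_pow 2 2).eq, ← mul_assoc, hkBB, one_mul]
  have eB : kA ^ 2 * K₁ ^ 2 = kB ^ 2 := by rw [hKsq, ← mul_assoc, hkAA, one_mul]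
  have eAK : kAinv * kBinv * K₁ = kAinv ^ 2 := by
    rw [hK1, caB.eq, mul_assoc, ← mul_assoc kBinv, hkB', one_mul, pow_two]
  have eBK : kA * kB * K₁ = kB ^ 2 := by
    rw [hK1, cAB.eq, mul_assoc, ← mul_assoc kA, hkA, one_mul, pow_two]
  have hDsq : D * K₁ ^ 2 = p₂ • (1 : R) + p₁ * K₁ := by
    rw [hD, hp1, hp2, hQA, hQB, add_mul (_ * _) _ K₁, mul_assoc _ (kA * kB), eBK,
      mul_assoc _ (kAinv * kBinv), eAK, cAB.mul_pow, cab.mul_pow]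
    have e₁ : kA ^ 2 * kB ^ 2 * K₁ ^ 2 = kB ^ 2 * kB ^ 2 := by
      rw [(cAB.pow_pow 2 2).eq, mul_assoc, eB]
    simp only [sub_mul, add_mul, smul_mul_assoc, e₁]
    simp only [mul_assoc _ _ (K₁ ^ 2), eA, eB, hkAA, hkBB]
    module
  calc _ = (K₁ ^ 2 * D + D * K₁ ^ 2 - (q ^ 2 + q⁻¹ ^ 2) • (K₁ * D * K₁))
        + (K₁ ^ 2 * X + X * K₁ ^ 2 - (q ^ 2 + q⁻¹ ^ 2) • (K₁ * X * K₁))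
        + (K₁ ^ 2 * Y + Y * K₁ ^ 2 - (q ^ 2 + q⁻¹ ^ 2) • (K₁ * Y * K₁))
        + ((q - q⁻¹) ^ 2) • (p₂ • (1 : R) + p₁ * K₁) := by
        rw [hK2']
        simp only [mul_add, add_mul, smul_add]
        abel
    _ = 0 := by
      rw [hDK, hXK, hYK, add_zero, add_zero, hDsq, ← add_smul]
      have hz : 2 - (q ^ 2 + q⁻¹ ^ 2) + (q - q⁻¹) ^ 2 = 0 := by
        field_simp
        ring
      rw [hz, zero_smul]
end

section
/- Askey–Wilson algebra AW(3) as hidden symmetry of the Hahn problem: define K₃ = q·K₁·K₂ − q⁻¹·K₂·K₁ and the structure coefficients B = (q − q⁻¹)²·(Q_B·k_A·k_B + Q_A·(k_A·k_B)⁻¹), C₁ = (q² − q⁻²)²·a₂·b₁ (a scalar), D₁ = (q − q⁻¹)²·(q + q⁻¹)·(a₂·Q_B·(k_A·k_B)⁻¹ + b₁·Q_A·k_A·k_B), and D₂ = (q − q⁻¹)²·(q + q⁻¹)·d (a scalar). Then q·K₂·K₃ − q⁻¹·K₃·K₂ = B·K₂ + C₁·K₁ + D₁ and q·K₃·K₁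 − q⁻¹·K₁·K₃ = B·K₁ + D₂·1. -/
section QuantumTriple

variable {R : Type*} [Ring R] [Algebra ℂ R]

/-- An inverse of `k` `q`-commutes with the inverse parameter. -/
lemma inv_mul_of_mul_eq_smul {q : ℂ} (hq : q ≠ 0) {k kinv x : R}
    (hk : k * kinv = 1) (hk' : kinv * k = 1) (h : k * x = q • (x * k)) :
    kinv * x = q⁻¹ • (x * kinv) := by
  calc kinv * x = q⁻¹ • (kinv * (q • (x * k)) * kinv) := by
        simp [mul_assoc, hk, smul_smul, hq]
    _ = q⁻¹ • (x * kinv) := by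
        rw [← h, ← mul_assoc kinv, hk', one_mul]

lemma sq_mul_of_mul_eq_smul {q : ℂ} {k x : R} (h : k * x = q • (x * k)) :
    k ^ 2 * x = q ^ 2 • (x * k ^ 2) := by
  rw [pow_two, mul_assoc, h, mul_smul_comm, ← mul_assoc, h, smul_mul_assoc, smul_smul, mul_assoc,
    pow_two]

lemma commute_mul_of_mul_eq_smul {q : ℂ} (hq : q ≠ 0) {k x y : R}
    (hx : k * x = q • (x * k)) (hy : k * y = q⁻¹ • (y * k)) : Commute k (x * y) := by
  rw [Commute, SemiconjBy, ← mul_assoc, hx, smul_mul_assoc, mul_assoc, hy, mul_smul_comm,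
    smul_smul, mul_inv_cancel₀ hq, one_smul, mul_assoc]

lemma mul_mul_mul_of_mul_eq_smul {a b : ℂ} {k l x y : R} (hx : k * x = a • (x * k))
    (hy : l * y = b • (y * l)) (hky : Commute k y) (hlx : Commute l x) :
    (k * l) * (x * y) = (a * b) • (x * y * (k * l)) := by
  calc (k * l) * (x * y) = (k * x) * (l * y) := hlx.mul_mul_mul_comm k y
    _ = (a * b) • ((x * k) * (y * l)) := by
      rw [hx, hy, smul_mul_assoc, mul_smul_comm, smul_smul]
    _ = (a * b) • (x * y * (k * l)) := by rw [hky.mul_mul_mul_comm x l]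

/-- The Casimir element of a realization of `sl_q(2)` commutes with its generators. -/
lemma casimir_commute {q : ℂ} (hq : q ≠ 0) {a₂ a₁ : ℂ} {k kinv Ap Am Q : R}
    (hk : k * kinv = 1) (hk' : kinv * k = 1)
    (h₁ : k * Ap = q • (Ap * k)) (h₂ : k * Am = q⁻¹ • (Am * k))
    (h₃ : Am * Ap - Ap * Am = (q - q⁻¹) • (a₁ • k ^ 2 - a₂ • kinv ^ 2))
    (hQ : Q = Ap * Am - (a₁ * q⁻¹) • k ^ 2 - (a₂ * q) • kinv ^ 2) :
    Commute Q k ∧ Commute Q kinv ∧ Commute Q Ap ∧ Commute Q Am := by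
  have h₁' := inv_mul_of_mul_eq_smul hq hk hk' h₁
  have h₂' := inv_mul_of_mul_eq_smul (inv_ne_zero hq) hk hk' h₂
  have hkk : Commute k kinv := hk.trans hk'.symm
  have hAA : Am * Ap = Ap * Am + (q - q⁻¹) • (a₁ • k ^ 2 - a₂ • kinv ^ 2) := by
    rw [← h₃]; abel
  subst hQ
  refine ⟨?_, ?_, ?_, ?_⟩
  · exact (((commute_mul_of_mul_eq_smul hq h₁ h₂).symm.sub_left
      (((Commute.refl k).pow_left 2).smul_left _)).sub_left ((hkk.symm.pow_left 2).smul_left _))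
  · exact (((commute_mul_of_mul_eq_smul (inv_ne_zero hq) h₁' h₂').symm.sub_left
      ((hkk.pow_left 2).smul_left _)).sub_left (((Commute.refl kinv).pow_left 2).smul_left _))
  · simp only [Commute, SemiconjBy, sub_mul, mul_sub, mul_assoc, hAA, smul_mul_assoc,
      mul_smul_comm, mul_add, sq_mul_of_mul_eq_smul h₁, sq_mul_of_mul_eq_smul h₁']
    match_scalars <;> field_simp <;> ring
  · simp only [Commute, SemiconjBy, sub_mul, mul_sub, ← mul_assoc, hAA, smul_mul_assoc,
      mul_smul_comm, add_mul]
    simp only [mul_assoc, sq_mul_of_mul_eq_smul h₂, sq_mul_of_mul_eq_smul h₂']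
    match_scalars <;> field_simp <;> ring

/-- The Askey–Wilson relations follow from a presentation of `K₂` as a `q`-shift operator:
`L` inverts `K₁`, `q²`-commutes with `T` and `S`, and `P` commutes with all three. -/
lemma askeyWilson_of_shift {q : ℂ} (hq : q ≠ 0) {c C : ℂ} {P L T S K₁ K₂ K₃ D : R}
    (hKL : K₁ * L = 1) (hLK : L * K₁ = 1)
    (hLT : L * T = q ^ 2 • (T * L)) (hLS : L * S = q⁻¹ ^ 2 • (S * L))
    (hPL : Commute L P) (hPT : Commute T P) (hPS : Commute S P)
    (hK₂ : K₂ = (P + ((q + q⁻¹) * c) • L + q • T + q⁻¹ • S) * L)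
    (hK₃ : K₃ = q • (K₁ * K₂) - q⁻¹ • (K₂ * K₁))
    (hTS : (q ^ 2 - q⁻¹ ^ 2) • ((T * S - S * T) * L)
      + ((q - q⁻¹) ^ 2 * (q + q⁻¹) * c) • ((P + ((q + q⁻¹) * c) • L) * L ^ 2)
      = C • K₁ + D) :
    q • (K₂ * K₃) - q⁻¹ • (K₃ * K₂) = ((q - q⁻¹) ^ 2 • P) * K₂ + C • K₁ + D ∧
    q • (K₃ * K₁) - q⁻¹ • (K₁ * K₃) =
      ((q - q⁻¹) ^ 2 • P) * K₁ + ((q - q⁻¹) ^ 2 * (q + q⁻¹) * c) • (1 : R) := by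
  have hKT : K₁ * T = (q ^ 2)⁻¹ • (T * K₁) := inv_mul_of_mul_eq_smul (pow_ne_zero 2 hq) hLK hKL hLT
  have hKS : K₁ * S = (q⁻¹ ^ 2)⁻¹ • (S * K₁) :=
    inv_mul_of_mul_eq_smul (pow_ne_zero 2 (inv_ne_zero hq)) hLK hKL hLS
  have hKP : K₁ * P = P * K₁ := by
    simpa using inv_mul_of_mul_eq_smul (one_ne_zero (α := ℂ)) hLK hKL (by simpa using hPL.eq)
  have hLT' (z : R) : L * (T * z) = q ^ 2 • (T * (L * z)) := by
    rw [← mul_assoc, hLT, smul_mul_assoc, mul_assoc]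
  have hLS' (z : R) : L * (S * z) = q⁻¹ ^ 2 • (S * (L * z)) := by
    rw [← mul_assoc, hLS, smul_mul_assoc, mul_assoc]
  have hK₃' : K₃ = (q - q⁻¹) • (P + ((q + q⁻¹) * c) • L) + (q ^ 2 - q⁻¹ ^ 2) • S := by
    have hK₁K₂ : K₁ * K₂ = P + ((q + q⁻¹) * c) • L + q⁻¹ • T + q • S := by
      simp only [hK₂, ← mul_assoc, mul_add, mul_smul_comm, hKP, hKL, hKT, hKS]
      simp only [add_mul, smul_mul_assoc, mul_assoc, hKL, one_mul, mul_one]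
      match_scalars <;> field_simp
    have hK₂K₁ : K₂ * K₁ = P + ((q + q⁻¹) * c) • L + q • T + q⁻¹ • S := by
      rw [hK₂, mul_assoc, hLK, mul_one]
    rw [hK₃, hK₁K₂, hK₂K₁]
    match_scalars <;> field_simp
    ring
  constructor
  · rw [add_assoc, ← hTS, hK₃', hK₂]
    simp only [pow_two L, mul_add, add_mul, sub_mul, smul_mul_assoc, mul_smul_comm,
      mul_assoc, hLT', hLS, hLS', hPL.eq, hPL.left_comm, hPT.left_comm, hPS.left_comm]
    match_scalars <;> field_simp <;> ring
  · rw [hK₃']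
    simp only [mul_add, add_mul, smul_mul_assoc, mul_smul_comm, hKP, hKL, hLK, hKS]
    match_scalars <;> field_simp <;> ring

end QuantumTriple

theorem AW3_hidden_symmetry {R : Type*} [Ring R] [Algebra ℂ R]
    (q : ℂ) (hq : q ≠ 0) (hq2 : q ^ 2 ≠ 1)
    (a₂ d b₁ : ℂ)
    (kA kAinv Ap Am kB kBinv Bp Bm : R)
    (hkA : kA * kAinv = 1) (hkA' : kAinv * kA = 1)
    (hkB : kB * kBinv = 1) (hkB' : kBinv * kB = 1)
    (hA1 : kA * Ap = q • (Ap * kA))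
    (hA2 : kA * Am = q⁻¹ • (Am * kA))
    (hA3 : Am * Ap - Ap * Am = (q - q⁻¹) • (d • kA ^ 2 - a₂ • kAinv ^ 2))
    (hB1 : kB * Bp = q • (Bp * kB))
    (hB2 : kB * Bm = q⁻¹ • (Bm * kB))
    (hB3 : Bm * Bp - Bp * Bm = (q - q⁻¹) • (b₁ • kB ^ 2 - d • kBinv ^ 2))
    (hcomm : ∀ x ∈ ({kA, kAinv, Ap, Am} : Set R),
             ∀ y ∈ ({kB, kBinv, Bp, Bm} : Set R), Commute x y)
    (QA QB : R)
    (hQA : QA = Ap * Am - (d * q⁻¹) • kA ^ 2 - (a₂ * q) • kAinv ^ 2)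
    (hQB : QB = Bp * Bm - (b₁ * q⁻¹) • kB ^ 2 - (d * q) • kBinv ^ 2)
    (K₁ K₂ : R)
    (hK1 : K₁ = kAinv * kB)
    (hK2 : K₂ = (Ap * kBinv + Bp * kA) * (Am * kBinv + Bm * kA)
      - (b₁ * q⁻¹) • (kA * kB) ^ 2 - (a₂ * q) • (kAinv * kBinv) ^ 2)
    (K₃ : R) (hK3 : K₃ = q • (K₁ * K₂) - q⁻¹ • (K₂ * K₁))
    (B : R) (hB : B = ((q - q⁻¹) ^ 2) • (QB * (kA * kB) + QA * (kAinv * kBinv)))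
    (C₁ : ℂ) (hC1 : C₁ = (q ^ 2 - (q⁻¹) ^ 2) ^ 2 * a₂ * b₁)
    (D₁ : R) (hD1 : D₁ = ((q - q⁻¹) ^ 2 * (q + q⁻¹)) •
      (a₂ • (QB * (kAinv * kBinv)) + b₁ • (QA * (kA * kB))))
    (D₂ : ℂ) (hD2 : D₂ = (q - q⁻¹) ^ 2 * (q + q⁻¹) * d) :
    q • (K₂ * K₃) - q⁻¹ • (K₃ * K₂) = B * K₂ + C₁ • K₁ + D₁ ∧
    q • (K₃ * K₁) - q⁻¹ • (K₁ * K₃) = B * K₁ + D₂ • (1 : R) := by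
  have hc {x y : R} (hx : x ∈ ({kA, kAinv, Ap, Am} : Set R))
      (hy : y ∈ ({kB, kBinv, Bp, Bm} : Set R)) : Commute x y := hcomm x hx y hy
  obtain ⟨hQAk, -, hQAp, hQAm⟩ := casimir_commute hq hkA hkA' hA1 hA2 hA3 hQA
  obtain ⟨-, hQBi, hQBp, hQBm⟩ := casimir_commute hq hkB hkB' hB1 hB2 hB3 hQB
  have hQAB {y : R} (hy : y ∈ ({kB, kBinv, Bp, Bm} : Set R)) : Commute QA y := by
    rw [hQA]
    exact (((hc (by simp) hy).mul_left (hc (by simp) hy)).sub_left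
      (((hc (by simp) hy).pow_left 2).smul_left _)).sub_left
      (((hc (by simp) hy).pow_left 2).smul_left _)
  have hQBA {x : R} (hx : x ∈ ({kA, kAinv, Ap, Am} : Set R)) : Commute QB x := by
    rw [hQB]
    exact (((hc hx (by simp)).symm.mul_left (hc hx (by simp)).symm).sub_left
      (((hc hx (by simp)).symm.pow_left 2).smul_left _)).sub_left
      (((hc hx (by simp)).symm.pow_left 2).smul_left _)
  have hA1i := inv_mul_of_mul_eq_smul hq hkA hkA' hA1
  have hA2i := inv_mul_of_mul_eq_smul (inv_ne_zero hq) hkA hkA' hA2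
  have hB1i := inv_mul_of_mul_eq_smul hq hkB hkB' hB1
  have hB2i := inv_mul_of_mul_eq_smul (inv_ne_zero hq) hkB hkB' hB2
  rw [inv_inv] at hA2i hB2i
  have hApAm : Ap * Am = QA + (d * q⁻¹) • kA ^ 2 + (a₂ * q) • kAinv ^ 2 := by rw [hQA]; abel
  have hBpBm : Bp * Bm = QB + (b₁ * q⁻¹) • kB ^ 2 + (d * q) • kBinv ^ 2 := by rw [hQB]; abel
  have hAmAp : Am * Ap = QA + (d * q) • kA ^ 2 + (a₂ * q⁻¹) • kAinv ^ 2 := by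
    rw [sub_eq_iff_eq_add.mp hA3, hApAm]; module
  have hBmBp : Bm * Bp = QB + (b₁ * q) • kB ^ 2 + (d * q⁻¹) • kBinv ^ 2 := by
    rw [sub_eq_iff_eq_add.mp hB3, hBpBm]; module
  have hkAkB := hc (x := kA) (y := kB) (by simp) (by simp)
  have hkAkBi := hc (x := kA) (y := kBinv) (by simp) (by simp)
  have hkAikB := hc (x := kAinv) (y := kB) (by simp) (by simp)
  have hkAikBi := hc (x := kAinv) (y := kBinv) (by simp) (by simp)
  have hAmBp := hc (x := Am) (y := Bp) (by simp) (by simp)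
  have hkkA : Commute kA kAinv := hkA.trans hkA'.symm
  have hkkB : Commute kB kBinv := hkB.trans hkB'.symm
  have hkA'_cancel (z : R) : kAinv * (kA * z) = z := by rw [← mul_assoc, hkA', one_mul]
  have hkB_cancel (z : R) : kB * (kBinv * z) = z := by rw [← mul_assoc, hkB, one_mul]
  have hkB'_cancel (z : R) : kBinv * (kB * z) = z := by rw [← mul_assoc, hkB', one_mul]
  have hLT : kA * kBinv * (Ap * Bm) = q ^ 2 • (Ap * Bm * (kA * kBinv)) := by
    rw [pow_two]
    exact mul_mul_mul_of_mul_eq_smul hA1 hB2i (hc (by simp) (by simp)) (hc (by simp) (by simp)).symm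
  have hLS : kA * kBinv * (Am * Bp) = q⁻¹ ^ 2 • (Am * Bp * (kA * kBinv)) := by
    rw [pow_two]
    exact mul_mul_mul_of_mul_eq_smul hA2 hB1i (hc (by simp) (by simp)) (hc (by simp) (by simp)).symm
  have hkCT : Commute (Ap * Bm) (kA * kB) := by
    simpa [Commute, SemiconjBy, hq] using
      (mul_mul_mul_of_mul_eq_smul hA1 hB2 (hc (by simp) (by simp))
        (hc (by simp) (by simp)).symm).symm
  have hkCS : Commute (Am * Bp) (kA * kB) := by
    simpa [Commute, SemiconjBy, hq] using
      (mul_mul_mul_of_mul_eq_smul hA2 hB1 (hc (by simp) (by simp))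
        (hc (by simp) (by simp)).symm).symm
  have hkCiT : Commute (Ap * Bm) (kAinv * kBinv) := by
    simpa [Commute, SemiconjBy, hq] using
      (mul_mul_mul_of_mul_eq_smul hA1i hB2i (hc (by simp) (by simp))
        (hc (by simp) (by simp)).symm).symm
  have hkCiS : Commute (Am * Bp) (kAinv * kBinv) := by
    simpa [Commute, SemiconjBy, hq] using
      (mul_mul_mul_of_mul_eq_smul hA2i hB1i (hc (by simp) (by simp))
        (hc (by simp) (by simp)).symm).symm
  have hcentral {x : R} (hA : Commute QA x) (hB : Commute QB x) (hk : Commute x (kA * kB))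
      (hki : Commute x (kAinv * kBinv)) :
      Commute x (QB * (kA * kB) + QA * (kAinv * kBinv)) :=
    (hB.symm.mul_right hk).add_right (hA.symm.mul_right hki)
  have hTS : Ap * Bm * (Am * Bp) - Am * Bp * (Ap * Bm)
      = (q - q⁻¹) • (b₁ • (QA * kB ^ 2) - d • (QA * kBinv ^ 2) + a₂ • (QB * kAinv ^ 2)
          - d • (QB * kA ^ 2))
        + (q ^ 2 - q⁻¹ ^ 2) • ((a₂ * b₁) • (kAinv ^ 2 * kB ^ 2) - d ^ 2 • (kA ^ 2 * kBinv ^ 2)) := by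
    rw [(hc (x := Am) (y := Bm) (by simp) (by simp)).symm.mul_mul_mul_comm,
      (hc (x := Ap) (y := Bp) (by simp) (by simp)).symm.mul_mul_mul_comm,
      hApAm, hBmBp, hAmAp, hBpBm]
    have hQBkA : Commute (kA ^ 2) QB := ((hQBA (by simp)).pow_right 2).symm
    have hQBkAi : Commute (kAinv ^ 2) QB := ((hQBA (by simp)).pow_right 2).symm
    simp only [add_mul, mul_add, smul_mul_assoc, mul_smul_comm, hQBkA.eq, hQBkAi.eq]
    match_scalars <;> field_simp <;> ring
  have hK₂ : K₂ = (QB * (kA * kB) + QA * (kAinv * kBinv) + ((q + q⁻¹) * d) • (kA * kBinv)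
      + q • (Ap * Bm) + q⁻¹ • (Am * Bp)) * (kA * kBinv) := by
    have hAA : Ap * kBinv * (Am * kBinv) = Ap * Am * kBinv ^ 2 := by
      rw [(hc (x := Am) (y := kBinv) (by simp) (by simp)).symm.mul_mul_mul_comm, pow_two]
    have hBB : Bp * kA * (Bm * kA) = Bp * Bm * kA ^ 2 := by
      rw [(hc (x := kA) (y := Bm) (by simp) (by simp)).mul_mul_mul_comm, pow_two]
    have hAB : Ap * kBinv * (Bm * kA) = q • (Ap * Bm * (kA * kBinv)) := by
      rw [mul_assoc Ap, ← mul_assoc kBinv, hB2i]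
      simp only [smul_mul_assoc, mul_smul_comm, mul_assoc, hkAkBi.eq]
    have hBA : Bp * kA * (Am * kBinv) = q⁻¹ • (Am * Bp * (kA * kBinv)) := by
      rw [mul_assoc Bp, ← mul_assoc kA, hA2]
      simp only [smul_mul_assoc, mul_smul_comm, mul_assoc, hAmBp.symm.left_comm]
    rw [hK2, add_mul, mul_add, mul_add, hAA, hBB, hAB, hBA, hApAm, hBpBm]
    simp only [pow_two, add_mul, smul_mul_assoc, mul_assoc, hkAkBi.symm.eq, hkAkBi.symm.left_comm,
      hkAkB.symm.eq, hkAkB.symm.left_comm, hkAikBi.symm.left_comm,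
      hkA'_cancel, hkB, mul_one]
    match_scalars <;> field_simp <;> ring
  rw [hB, hD2]
  refine askeyWilson_of_shift (L := kA * kBinv) hq ?_ ?_ hLT hLS ?_ ?_ ?_ hK₂ hK3 ?_
  · rw [hK1, hkAikB.eq, mul_assoc, hkA'_cancel, hkB]
  · rw [hK1, hkAikB.eq, mul_assoc, hkB'_cancel, hkA]
  · exact hcentral (hQAk.mul_right (hQAB (by simp))) ((hQBA (by simp)).mul_right hQBi)
      (.mul_left (.mul_right (.refl _) hkAkB) (.mul_right hkAkBi.symm hkkB.symm))
      (.mul_left (.mul_right hkkA hkAkBi) (.mul_right hkAikBi.symm (.refl _)))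
  · exact hcentral (hQAp.mul_right (hQAB (by simp))) ((hQBA (by simp)).mul_right hQBm) hkCT hkCiT
  · exact hcentral (hQAm.mul_right (hQAB (by simp))) ((hQBA (by simp)).mul_right hQBp) hkCS hkCiS
  · rw [hTS, hK1, hC1, hD1]
    simp only [pow_two kA, pow_two kB, pow_two kAinv, pow_two kBinv, pow_two (kA * kBinv), add_mul,
      sub_mul, smul_mul_assoc, mul_assoc,
      hkAkBi.symm.left_comm, hkAkB.symm.eq, hkAkB.symm.left_comm, hkA'_cancel, hkB, hkB_cancel,
      mul_one]
    match_scalars <;> field_simp <;> ring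
end

section
/- Hidden symmetry for the sum of two q-oscillator algebras eu_q^+ ⊕ eu_q^−: in the special case d = 0 (so that the first triple is an (a₂,0)-triple and the second a (0,b₁)-triple), one has q·K₃·K₁ − q⁻¹·K₁·K₃ = B·K₁, where K₃ = q·K₁·K₂ − q⁻¹·K₂·K₁ and B = (q − q⁻¹)²·(Q_B·k_A·k_B + Q_A·(k_A·k_B)⁻¹); i.e. the structure constant D₂ vanishes. -/
/-- `k` and `x` commute up to the scalar `w`. -/
def QCommute {R : Type*} [Ring R] [Algebra ℂ R] (w : ℂ) (k x : R) : Prop :=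
  k * x = w • (x * k)

namespace QCommute

variable {R : Type*} [Ring R] [Algebra ℂ R] {v w : ℂ} {k l x y : R}

theorem of_commute (h : Commute k x) : QCommute 1 k x := by
  rw [QCommute, one_smul, h.eq]

theorem mul_right (hx : QCommute w k x) (hy : QCommute v k y) : QCommute (w * v) k (x * y) := by
  unfold QCommute at *
  rw [← mul_assoc, hx, smul_mul_assoc, mul_assoc, hy, mul_smul_comm, smul_smul, mul_assoc]

theorem mul_left (hk : QCommute w k x) (hl : QCommute v l x) : QCommute (w * v) (k * l) x := by
  unfold QCommute at *
  rw [mul_assoc, hl, mul_smul_comm, ← mul_assoc, hk, smul_mul_assoc, smul_smul, mul_assoc,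
    mul_comm v]

theorem add_right (hx : QCommute w k x) (hy : QCommute w k y) : QCommute w k (x + y) := by
  unfold QCommute at *
  rw [mul_add, hx, hy, add_mul, smul_add]

theorem sub_right (hx : QCommute w k x) (hy : QCommute w k y) : QCommute w k (x - y) := by
  unfold QCommute at *
  rw [mul_sub, hx, hy, sub_mul, smul_sub]

theorem smul_right (c : ℂ) (hx : QCommute w k x) : QCommute w k (c • x) := by
  unfold QCommute at *
  rw [mul_smul_comm, hx, smul_mul_assoc, smul_comm]

theorem inv_left (hw : w ≠ 0) (h : QCommute w k x) (hkl : k * l = 1) (hlk : l * k = 1) :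
    QCommute w⁻¹ l x := by
  unfold QCommute at *
  have hxl : x * l = w • (l * x) := by
    calc x * l = l * (k * x) * l := by rw [← mul_assoc, hlk, one_mul]
      _ = w • (l * x * (k * l)) := by
        rw [h, mul_smul_comm, smul_mul_assoc]
        simp only [mul_assoc]
      _ = w • (l * x) := by rw [hkl, mul_one]
  rw [hxl, inv_smul_smul₀ hw]

/-- The iterated `q`-commutator of an element that commutes with `k` up to `w`. -/
theorem iterated_qcommutator (q : ℂ) (h : QCommute w k x) :
    q • ((q • (k * x) - q⁻¹ • (x * k)) * k) - q⁻¹ • (k * (q • (k * x) - q⁻¹ • (x * k))) =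
      ((q * w - q⁻¹) * (q - q⁻¹ * w)) • (x * k * k) := by
  unfold QCommute at h
  have hk : k * (x * k) = w • (x * k * k) := by rw [← mul_assoc, h, smul_mul_assoc]
  simp only [h, sub_mul, mul_sub, smul_mul_assoc, mul_smul_comm, hk]
  module

end QCommute

theorem hidden_symmetry_qoscillator_sum {R : Type*} [Ring R] [Algebra ℂ R]
    (q : ℂ) (hq : q ≠ 0) (hq2 : q ^ 2 ≠ 1)
    (a₂ d b₁ : ℂ)
    (kA kAinv Ap Am kB kBinv Bp Bm : R)
    (hkA : kA * kAinv = 1) (hkA' : kAinv * kA = 1)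
    (hkB : kB * kBinv = 1) (hkB' : kBinv * kB = 1)
    (hA1 : kA * Ap = q • (Ap * kA))
    (hA2 : kA * Am = q⁻¹ • (Am * kA))
    (hA3 : Am * Ap - Ap * Am = (q - q⁻¹) • (d • kA ^ 2 - a₂ • kAinv ^ 2))
    (hB1 : kB * Bp = q • (Bp * kB))
    (hB2 : kB * Bm = q⁻¹ • (Bm * kB))
    (hB3 : Bm * Bp - Bp * Bm = (q - q⁻¹) • (b₁ • kB ^ 2 - d • kBinv ^ 2))
    (hcomm : ∀ x ∈ ({kA, kAinv, Ap, Am} : Set R),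
             ∀ y ∈ ({kB, kBinv, Bp, Bm} : Set R), Commute x y)
    (hd : d = 0)
    (QA QB : R)
    (hQA : QA = Ap * Am - (d * q⁻¹) • kA ^ 2 - (a₂ * q) • kAinv ^ 2)
    (hQB : QB = Bp * Bm - (b₁ * q⁻¹) • kB ^ 2 - (d * q) • kBinv ^ 2)
    (K₁ K₂ : R)
    (hK1 : K₁ = kAinv * kB)
    (hK2 : K₂ = (Ap * kBinv + Bp * kA) * (Am * kBinv + Bm * kA)
      - (b₁ * q⁻¹) • (kA * kB) ^ 2 - (a₂ * q) • (kAinv * kBinv) ^ 2)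
    (K₃ : R) (hK3 : K₃ = q • (K₁ * K₂) - q⁻¹ • (K₂ * K₁))
    (B : R) (hB : B = ((q - q⁻¹) ^ 2) • (QB * (kA * kB) + QA * (kAinv * kBinv))) :
    q • (K₃ * K₁) - q⁻¹ • (K₁ * K₃) = B * K₁ := by
  subst hd
  simp only [Set.mem_insert_iff, Set.mem_singleton_iff, forall_eq_or_imp, forall_eq] at hcomm
  obtain ⟨⟨cAB, -, -, cABm⟩, ⟨ciB, ciBi, ciBp, ciBm⟩, ⟨cpB, -⟩,
    ⟨cmB, cmBi, -⟩⟩ := hcomm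
  have hq' : q⁻¹ ≠ 0 := inv_ne_zero hq
  have cA : Commute kAinv kA := hkA'.trans hkA.symm
  have cB : Commute kB kBinv := hkB.trans hkB'.symm
  have wkA : QCommute 1 K₁ kA := .of_commute (hK1 ▸ cA.mul_left cAB.symm)
  have wkAinv : QCommute 1 K₁ kAinv :=
    .of_commute (hK1 ▸ (Commute.refl _).mul_left ciB.symm)
  have wkBinv : QCommute 1 K₁ kBinv := .of_commute (hK1 ▸ ciBi.mul_left cB)
  have wkB : QCommute 1 K₁ kB := .of_commute (hK1 ▸ ciB.mul_left (Commute.refl _))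
  have wAp : QCommute q⁻¹ K₁ Ap := by
    simpa [hK1] using (QCommute.inv_left hq hA1 hkA hkA').mul_left (.of_commute cpB.symm)
  have wAm : QCommute q K₁ Am := by
    simpa [hK1] using (QCommute.inv_left hq' hA2 hkA hkA').mul_left (.of_commute cmB.symm)
  have wBp : QCommute q K₁ Bp := by
    simpa [hK1] using (QCommute.of_commute ciBp).mul_left hB1
  have wBm : QCommute q⁻¹ K₁ Bm := by
    simpa [hK1] using (QCommute.of_commute ciBm).mul_left hB2
  have wQA : QCommute 1 K₁ QA := by
    have h₁ := wAp.mul_right wAm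
    have h₂ := wkAinv.mul_right wkAinv
    rw [inv_mul_cancel₀ hq] at h₁
    rw [one_mul, ← sq] at h₂
    simpa [hQA] using h₁.sub_right (h₂.smul_right (a₂ * q))
  have wQB : QCommute 1 K₁ QB := by
    have h₁ := wBp.mul_right wBm
    have h₂ := wkB.mul_right wkB
    rw [mul_inv_cancel₀ hq] at h₁
    rw [one_mul, ← sq] at h₂
    simpa [hQB] using h₁.sub_right (h₂.smul_right (b₁ * q⁻¹))
  have wZ : QCommute 1 K₁ (QA * (kBinv * kBinv) + QB * (kA * kA)) := by
    have h₁ := wQA.mul_right (wkBinv.mul_right wkBinv)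
    have h₂ := wQB.mul_right (wkA.mul_right wkA)
    simp only [one_mul] at h₁ h₂
    exact h₁.add_right h₂
  have wX := (wAp.mul_right wkBinv).mul_right (wBm.mul_right wkA)
  have wY := (wBp.mul_right wkA).mul_right (wAm.mul_right wkBinv)
  have tZ := wZ.iterated_qcommutator q
  have tX := wX.iterated_qcommutator q
  have tY := wY.iterated_qcommutator q
  have zX : q * (q⁻¹ * 1 * (q⁻¹ * 1)) - q⁻¹ = 0 := by field_simp; ring
  have zY : q - q⁻¹ * (q * 1 * (q * 1)) = 0 := by field_simp; ring
  rw [zX, zero_mul, zero_smul] at tX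
  rw [zY, mul_zero, zero_smul] at tY
  have hsplit : K₂ = (QA * (kBinv * kBinv) + QB * (kA * kA)) + Ap * kBinv * (Bm * kA)
      + Bp * kA * (Am * kBinv) := by
    have h₁ : Ap * kBinv * (Am * kBinv) = Ap * Am * (kBinv * kBinv) :=
      cmBi.symm.mul_mul_mul_comm _ _
    have h₂ : Bp * kA * (Bm * kA) = Bp * Bm * (kA * kA) := cABm.mul_mul_mul_comm _ _
    have h₃ : kA * kB * (kA * kB) = kB * kB * (kA * kA) := by
      rw [cAB.symm.mul_mul_mul_comm]
      exact (cAB.mul_right cAB).mul_left (cAB.mul_right cAB)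
    have h₄ : kAinv * kBinv * (kAinv * kBinv) = kAinv * kAinv * (kBinv * kBinv) :=
      ciBi.symm.mul_mul_mul_comm _ _
    simp only [hK2, hQA, hQB, sq, mul_add, add_mul, sub_mul, smul_mul_assoc, h₁, h₂, h₃, h₄,
      zero_mul, zero_smul, sub_zero]
    abel
  have hZK : (QA * (kBinv * kBinv) + QB * (kA * kA)) * K₁ =
      QB * (kA * kB) + QA * (kAinv * kBinv) := by
    have h₁ : kBinv * kBinv * (kAinv * kB) = kAinv * kBinv := by
      rw [ciB.eq, mul_assoc, ← mul_assoc kBinv kB, hkB', one_mul, ciBi.eq]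
    have h₂ : kA * kA * (kAinv * kB) = kA * kB := by
      rw [mul_assoc, ← mul_assoc kA kAinv, hkA, one_mul]
    rw [hK1, add_mul, mul_assoc QA, mul_assoc QB, h₁, h₂, add_comm]
  rw [hB, ← hZK, hK3, hsplit]
  calc _ = _ := ?_
    _ = _ := congrArg₂ (· + ·) (congrArg₂ (· + ·) tZ tX) tY
    _ = _ := ?_
  · simp only [mul_add, add_mul, mul_sub, sub_mul, smul_add, smul_sub]
    abel
  · rw [add_zero, add_zero, mul_one, mul_one, smul_mul_assoc, sq]
end

section
/- Tridiagonal action of the total Casimir on the product basis: for all n, m ∈ ℕ, Q_C·(eₙ ⊗ fₘ) = D_{n,m}·(eₙ ⊗ fₘ) + q^{n−m+1}·w_a·w_b⁻¹·r^a_{n+1}·r^b_m·(e_{n+1} ⊗ f_{m−1}) + q^{n−m−1}·w_a·w_b⁻¹·r^a_n·r^b_{m+1}·(e_{n−1} ⊗ f_{m+1}), where the diagonal coefficient is D_{n,m} = (q + q⁻¹)·d·q^{2(n−m)}·w_a²·w_b⁻² + (Q_b·q^{n+m}·w_a·w_b + Q_a·q^{−(n+m)}·w_a⁻¹·w_b⁻¹)·q^{n−m}·w_a·w_b⁻¹.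 -/
/-- The tensor product `V_a ⊗ V_b` of two complex vector spaces with bases
`(eₙ)` and `(fₘ)` is modelled by its product basis: `V = (ℕ × ℕ) →₀ ℂ`,
with `eₙ ⊗ fₘ := Finsupp.single (n, m) 1`. -/
noncomputable def tensorOp (g : ℕ × ℕ → ((ℕ × ℕ) →₀ ℂ)) :
    Module.End ℂ ((ℕ × ℕ) →₀ ℂ) :=
  Finsupp.lsum ℂ fun p => LinearMap.toSpanSingleton ℂ ((ℕ × ℕ) →₀ ℂ) (g p)

theorem tensorOp_single (g : ℕ × ℕ → ((ℕ × ℕ) →₀ ℂ)) (p : ℕ × ℕ) :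
    tensorOp g (Finsupp.single p 1) = g p := by
  simp [tensorOp]

theorem casimir_tridiagonal_action (q wa wb : ℂ) (hq : q ≠ 0) (hq2 : q ^ 2 ≠ 1)
    (hwa : wa ≠ 0) (hwb : wb ≠ 0)
    (a₂ d b₁ : ℂ) (ra rb : ℕ → ℂ) (hra0 : ra 0 = 0) (hrb0 : rb 0 = 0)
    (hra : ∀ n : ℕ, (ra n) ^ 2
      = (q ^ n - (q⁻¹) ^ n) * (d * q ^ n * q⁻¹ * wa ^ 2 - a₂ * q * (q⁻¹) ^ n * (wa⁻¹) ^ 2))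
    (hrb : ∀ n : ℕ, (rb n) ^ 2
      = (q ^ n - (q⁻¹) ^ n) * (b₁ * q ^ n * q⁻¹ * wb ^ 2 - d * q * (q⁻¹) ^ n * (wb⁻¹) ^ 2))
    (kA kAinv Ap Am kB kBinv Bp Bm : Module.End ℂ ((ℕ × ℕ) →₀ ℂ))
    (hkA : kA = tensorOp fun p => (q ^ p.1 * wa) • Finsupp.single p 1)
    (hkAinv : kAinv = tensorOp fun p => (q ^ p.1 * wa)⁻¹ • Finsupp.single p 1)
    (hAp : Ap = tensorOp fun p => ra (p.1 + 1) • Finsupp.single (p.1 + 1, p.2) 1)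
    (hAm : Am = tensorOp fun p =>
      if p.1 = 0 then 0 else ra p.1 • Finsupp.single (p.1 - 1, p.2) 1)
    (hkB : kB = tensorOp fun p => (q ^ p.2 * wb) • Finsupp.single p 1)
    (hkBinv : kBinv = tensorOp fun p => (q ^ p.2 * wb)⁻¹ • Finsupp.single p 1)
    (hBp : Bp = tensorOp fun p => rb (p.2 + 1) • Finsupp.single (p.1, p.2 + 1) 1)
    (hBm : Bm = tensorOp fun p =>
      if p.2 = 0 then 0 else rb p.2 • Finsupp.single (p.1, p.2 - 1) 1)
    (QC : Module.End ℂ ((ℕ × ℕ) →₀ ℂ))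
    (hQC : QC = (Ap * kBinv + Bp * kA) * (Am * kBinv + Bm * kA)
      - (b₁ * q⁻¹) • (kA * kB) ^ 2 - (a₂ * q) • (kAinv * kBinv) ^ 2)
    (Qa Qb : ℂ)
    (hQa : Qa = -(d * q⁻¹ * wa ^ 2) - a₂ * q * (wa⁻¹) ^ 2)
    (hQb : Qb = -(b₁ * q⁻¹ * wb ^ 2) - d * q * (wb⁻¹) ^ 2)
    (D : ℕ → ℕ → ℂ)
    (hD : ∀ n m : ℕ, D n m
      = (q + q⁻¹) * d * (q ^ n * (q⁻¹) ^ m) ^ 2 * wa ^ 2 * (wb⁻¹) ^ 2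
        + (Qb * q ^ (n + m) * wa * wb + Qa * (q⁻¹) ^ (n + m) * wa⁻¹ * wb⁻¹)
          * (q ^ n * (q⁻¹) ^ m * wa * wb⁻¹))
    :
    ∀ n m : ℕ, QC (Finsupp.single (n, m) 1)
      = D n m • Finsupp.single (n, m) 1
        + (q ^ (n + 1) * (q⁻¹) ^ m * wa * wb⁻¹ * ra (n + 1) * rb m) •
            (if m = 0 then 0 else Finsupp.single (n + 1, m - 1) 1)
        + (q ^ n * (q⁻¹) ^ (m + 1) * wa * wb⁻¹ * ra n * rb (m + 1)) •
            (if n = 0 then 0 else Finsupp.single (n - 1, m + 1) 1) := by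
  intro n m
  have hdiag : ra n ^ 2 * ((q ^ m * wb)⁻¹) ^ 2 + rb m ^ 2 * (q ^ n * wa) ^ 2
      - b₁ * q⁻¹ * (q ^ n * wa * (q ^ m * wb)) ^ 2
      - a₂ * q * ((q ^ n * wa)⁻¹ * (q ^ m * wb)⁻¹) ^ 2 = D n m := by
    simp only [hra, hrb, hD, hQa, hQb, pow_add, inv_pow]
    field_simp
    ring
  rw [← hdiag]
  subst hQC hkA hkAinv hAp hAm hkB hkBinv hBp hBm
  rcases n with _ | n <;> rcases m with _ | m <;>
    simp only [LinearMap.sub_apply, LinearMap.add_apply, LinearMap.smul_apply,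
      Module.End.mul_apply, pow_two (_ : Module.End ℂ _), map_add, map_smul, tensorOp_single,
      hra0, hrb0, if_true, Nat.add_eq_zero_iff, one_ne_zero, and_false, if_false,
      Nat.add_sub_cancel, smul_zero, map_zero, inv_pow] <;>
    match_scalars <;> field_simp <;> ring
end

section
/- Three-term recurrence for the Clebsch–Gordan problem: fix N ∈ ℕ, λ ∈ ℂ, and coefficients c₀, …, c_N ∈ ℂ (with the conventions c_{−1} = c_{N+1} = 0), and set v = Σ_{n=0}^{N} cₙ·(eₙ ⊗ f_{N−n}). Then Q_C·v = λ·v if and only if for every 0 ≤ n ≤ N: λ·cₙ = D_{n,N−n}·cₙ + q^{2n−N−1}·w_a·w_b⁻¹·r^a_n·r^b_{N−n+1}·c_{n−1} + q^{2n−N+1}·w_a·w_b⁻¹·r^a_{n+1}·r^b_{N−n}·c_{n+1}, where D_{n,m} = (q + q⁻¹)·d·q^{2(n−m)}·w_a²·w_b⁻² + (Q_b·q^{n+m}·w_a·w_b + Q_a·q^{−(n+m)}·w_a⁻¹·w_b⁻¹)·q^{n−m}·w_a·w_b⁻¹. -/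
/-- The vectors `eₙ ⊗ f_{N-n}` with `n ≤ N` are linearly independent. -/
theorem sum_smul_single_antidiagonal_inj (N : ℕ) (x y : ℕ → ℂ) :
    (∑ n ∈ Finset.range (N + 1), x n • Finsupp.single (n, N - n) (1 : ℂ)
      = ∑ n ∈ Finset.range (N + 1), y n • Finsupp.single (n, N - n) (1 : ℂ)) ↔
      ∀ n ≤ N, x n = y n := by
  have coeff (z : ℕ → ℂ) (n : ℕ) (hn : n ≤ N) :
      (∑ k ∈ Finset.range (N + 1), z k • Finsupp.single (k, N - k) (1 : ℂ)) (n, N - n)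
        = z n := by
    rw [Finsupp.finsetSum_apply, Finset.sum_eq_single n]
    · simp
    · intro k _ hk
      simp [hk]
    · intro h
      exact absurd (Finset.mem_range.2 (Nat.lt_succ_of_le hn)) h
  constructor
  · intro h n hn
    rw [← coeff x n hn, h, coeff y n hn]
  · intro h
    refine Finset.sum_congr rfl fun n hn => ?_
    rw [h n (Nat.lt_succ_iff.1 (Finset.mem_range.1 hn))]

/-- An operator that is tridiagonal along the antidiagonals of the product basis acts on the
coefficients of a vector supported on one antidiagonal by a three-term formula. -/
theorem tridiagonal_apply_sum (T : Module.End ℂ ((ℕ × ℕ) →₀ ℂ)) (D L U : ℕ → ℕ → ℂ)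
    (hL : ∀ m, L 0 m = 0) (hU : ∀ n, U n 0 = 0)
    (hT : ∀ n m, T (Finsupp.single (n, m) 1) = D n m • Finsupp.single (n, m) 1
      + L n m • Finsupp.single (n - 1, m + 1) 1 + U n m • Finsupp.single (n + 1, m - 1) 1)
    (N : ℕ) (c : ℕ → ℂ) :
    T (∑ n ∈ Finset.range (N + 1), c n • Finsupp.single (n, N - n) 1)
      = ∑ n ∈ Finset.range (N + 1),
        (D n (N - n) * c n
          + U (n - 1) (N - n + 1) * (if n = 0 then 0 else c (n - 1))
          + L (n + 1) (N - n - 1) * (if n = N then 0 else c (n + 1))) •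
            Finsupp.single (n, N - n) (1 : ℂ) := by
  have lower : ∑ n ∈ Finset.range (N + 1),
        (c n * L n (N - n)) • Finsupp.single (n - 1, N - n + 1) (1 : ℂ)
      = ∑ n ∈ Finset.range (N + 1),
        (L (n + 1) (N - n - 1) * (if n = N then 0 else c (n + 1))) •
          Finsupp.single (n, N - n) (1 : ℂ) := by
    rw [Finset.sum_range_succ', Finset.sum_range_succ]
    simp only [hL, mul_zero, zero_smul, if_true]
    congr 1
    refine Finset.sum_congr rfl fun n hn => ?_
    have hn' := Finset.mem_range.1 hn
    rw [if_neg hn'.ne, mul_comm, Nat.add_sub_cancel, Nat.sub_sub,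
      show N - (n + 1) + 1 = N - n by omega]
  have upper : ∑ n ∈ Finset.range (N + 1),
        (c n * U n (N - n)) • Finsupp.single (n + 1, N - n - 1) (1 : ℂ)
      = ∑ n ∈ Finset.range (N + 1),
        (U (n - 1) (N - n + 1) * (if n = 0 then 0 else c (n - 1))) •
          Finsupp.single (n, N - n) (1 : ℂ) := by
    rw [Finset.sum_range_succ, Finset.sum_range_succ']
    simp only [Nat.sub_self, hU, mul_zero, zero_smul, if_true]
    congr 1
    refine Finset.sum_congr rfl fun n hn => ?_
    have hn' := Finset.mem_range.1 hn
    rw [if_neg n.succ_ne_zero, mul_comm, Nat.add_sub_cancel, Nat.sub_sub,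
      show N - (n + 1) + 1 = N - n by omega]
  simp only [map_sum, map_smul, hT, smul_add, smul_smul, add_smul, Finset.sum_add_distrib]
  rw [lower, upper, add_right_comm]
  simp only [mul_comm]

theorem three_term_recurrence (q wa wb : ℂ) (hq : q ≠ 0) (hq2 : q ^ 2 ≠ 1)
    (hwa : wa ≠ 0) (hwb : wb ≠ 0)
    (a₂ d b₁ : ℂ) (ra rb : ℕ → ℂ) (hra0 : ra 0 = 0) (hrb0 : rb 0 = 0)
    (hra : ∀ n : ℕ, (ra n) ^ 2
      = (q ^ n - (q⁻¹) ^ n) * (d * q ^ n * q⁻¹ * wa ^ 2 - a₂ * q * (q⁻¹) ^ n * (wa⁻¹) ^ 2))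
    (hrb : ∀ n : ℕ, (rb n) ^ 2
      = (q ^ n - (q⁻¹) ^ n) * (b₁ * q ^ n * q⁻¹ * wb ^ 2 - d * q * (q⁻¹) ^ n * (wb⁻¹) ^ 2))
    (kA kAinv Ap Am kB kBinv Bp Bm : Module.End ℂ ((ℕ × ℕ) →₀ ℂ))
    (hkA : kA = tensorOp fun p => (q ^ p.1 * wa) • Finsupp.single p 1)
    (hkAinv : kAinv = tensorOp fun p => (q ^ p.1 * wa)⁻¹ • Finsupp.single p 1)
    (hAp : Ap = tensorOp fun p => ra (p.1 + 1) • Finsupp.single (p.1 + 1, p.2) 1)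
    (hAm : Am = tensorOp fun p =>
      if p.1 = 0 then 0 else ra p.1 • Finsupp.single (p.1 - 1, p.2) 1)
    (hkB : kB = tensorOp fun p => (q ^ p.2 * wb) • Finsupp.single p 1)
    (hkBinv : kBinv = tensorOp fun p => (q ^ p.2 * wb)⁻¹ • Finsupp.single p 1)
    (hBp : Bp = tensorOp fun p => rb (p.2 + 1) • Finsupp.single (p.1, p.2 + 1) 1)
    (hBm : Bm = tensorOp fun p =>
      if p.2 = 0 then 0 else rb p.2 • Finsupp.single (p.1, p.2 - 1) 1)
    (QC : Module.End ℂ ((ℕ × ℕ) →₀ ℂ))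
    (hQC : QC = (Ap * kBinv + Bp * kA) * (Am * kBinv + Bm * kA)
      - (b₁ * q⁻¹) • (kA * kB) ^ 2 - (a₂ * q) • (kAinv * kBinv) ^ 2)
    (Qa Qb : ℂ)
    (hQa : Qa = -(d * q⁻¹ * wa ^ 2) - a₂ * q * (wa⁻¹) ^ 2)
    (hQb : Qb = -(b₁ * q⁻¹ * wb ^ 2) - d * q * (wb⁻¹) ^ 2)
    (D : ℕ → ℕ → ℂ)
    (hD : ∀ n m : ℕ, D n m
      = (q + q⁻¹) * d * (q ^ n * (q⁻¹) ^ m) ^ 2 * wa ^ 2 * (wb⁻¹) ^ 2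
        + (Qb * q ^ (n + m) * wa * wb + Qa * (q⁻¹) ^ (n + m) * wa⁻¹ * wb⁻¹)
          * (q ^ n * (q⁻¹) ^ m * wa * wb⁻¹))
    (N : ℕ) (lam : ℂ) (c : ℕ → ℂ)
    (v : (ℕ × ℕ) →₀ ℂ)
    (hv : v = ∑ n ∈ Finset.range (N + 1), c n • Finsupp.single (n, N - n) 1) :
    QC v = lam • v ↔
      ∀ n ≤ N, lam * c n
        = D n (N - n) * c n
          + q ^ (2 * n) * (q⁻¹) ^ (N + 1) * wa * wb⁻¹ * ra n * rb (N - n + 1) *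
              (if n = 0 then 0 else c (n - 1))
          + q ^ (2 * n + 1) * (q⁻¹) ^ N * wa * wb⁻¹ * ra (n + 1) * rb (N - n) *
              (if n = N then 0 else c (n + 1)) := by
  have eAp (n m : ℕ) : Ap (Finsupp.single (n, m) 1)
      = ra (n + 1) • Finsupp.single (n + 1, m) 1 := by rw [hAp, tensorOp_single]
  have eBp (n m : ℕ) : Bp (Finsupp.single (n, m) 1)
      = rb (m + 1) • Finsupp.single (n, m + 1) 1 := by rw [hBp, tensorOp_single]
  have eAm (n m : ℕ) : Am (Finsupp.single (n, m) 1)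
      = ra n • Finsupp.single (n - 1, m) 1 := by
    rw [hAm, tensorOp_single]
    by_cases h : n = 0 <;> simp [h, hra0]
  have eBm (n m : ℕ) : Bm (Finsupp.single (n, m) 1)
      = rb m • Finsupp.single (n, m - 1) 1 := by
    rw [hBm, tensorOp_single]
    by_cases h : m = 0 <;> simp [h, hrb0]
  have ekA (n m : ℕ) : kA (Finsupp.single (n, m) 1)
      = (q ^ n * wa) • Finsupp.single (n, m) 1 := by rw [hkA, tensorOp_single]
  have ekB (n m : ℕ) : kB (Finsupp.single (n, m) 1)
      = (q ^ m * wb) • Finsupp.single (n, m) 1 := by rw [hkB, tensorOp_single]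
  have ekAinv (n m : ℕ) : kAinv (Finsupp.single (n, m) 1)
      = (q ^ n * wa)⁻¹ • Finsupp.single (n, m) 1 := by rw [hkAinv, tensorOp_single]
  have ekBinv (n m : ℕ) : kBinv (Finsupp.single (n, m) 1)
      = (q ^ m * wb)⁻¹ • Finsupp.single (n, m) 1 := by rw [hkBinv, tensorOp_single]
  have eCm (n m : ℕ) : (Am * kBinv + Bm * kA) (Finsupp.single (n, m) 1)
      = ((q ^ m * wb)⁻¹ * ra n) • Finsupp.single (n - 1, m) 1
        + (q ^ n * wa * rb m) • Finsupp.single (n, m - 1) 1 := by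
    simp only [LinearMap.add_apply, Module.End.mul_apply, ekA, ekBinv, map_smul, eAm, eBm,
      smul_smul]
  have eCp (n m : ℕ) : (Ap * kBinv + Bp * kA) (Finsupp.single (n, m) 1)
      = ((q ^ m * wb)⁻¹ * ra (n + 1)) • Finsupp.single (n + 1, m) 1
        + (q ^ n * wa * rb (m + 1)) • Finsupp.single (n, m + 1) 1 := by
    simp only [LinearMap.add_apply, Module.End.mul_apply, ekA, ekBinv, map_smul, eAp, eBp,
      smul_smul]
  have ediag (n m : ℕ) : D n m = ((q ^ m * wb)⁻¹) ^ 2 * ra n ^ 2 + (q ^ n * wa) ^ 2 * rb m ^ 2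
      - b₁ * q⁻¹ * (q ^ n * wa * (q ^ m * wb)) ^ 2
      - a₂ * q * ((q ^ n * wa)⁻¹ * (q ^ m * wb)⁻¹) ^ 2 := by
    rw [hD, hra, hrb, hQa, hQb]
    simp only [pow_add, inv_pow]
    have hn : q ^ n ≠ 0 := pow_ne_zero n hq
    have hm : q ^ m ≠ 0 := pow_ne_zero m hq
    generalize q ^ n = x at *
    generalize q ^ m = y at *
    field_simp
    ring
  have eQC (n m : ℕ) : QC (Finsupp.single (n, m) 1) = D n m • Finsupp.single (n, m) 1
      + (q ^ n * q⁻¹ * (q⁻¹) ^ m * wa * wb⁻¹ * ra n * rb (m + 1)) •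
          Finsupp.single (n - 1, m + 1) 1
      + (q ^ n * q * (q⁻¹) ^ m * wa * wb⁻¹ * ra (n + 1) * rb m) •
          Finsupp.single (n + 1, m - 1) 1 := by
    have lowA : (ra n) • (Ap * kBinv + Bp * kA) (Finsupp.single (n - 1, m) 1)
        = ((q ^ m * wb)⁻¹ * ra n ^ 2) • Finsupp.single (n, m) 1
          + (q ^ n * q⁻¹ * wa * ra n * rb (m + 1)) • Finsupp.single (n - 1, m + 1) 1 := by
      rcases n with _ | n
      · simp [hra0]
      · rw [eCp, Nat.add_sub_cancel, smul_add, smul_smul, smul_smul]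
        congr 2
        · ring
        · field_simp
          ring
    have lowB : (rb m) • (Ap * kBinv + Bp * kA) (Finsupp.single (n, m - 1) 1)
        = (q * (q ^ m * wb)⁻¹ * ra (n + 1) * rb m) • Finsupp.single (n + 1, m - 1) 1
          + (q ^ n * wa * rb m ^ 2) • Finsupp.single (n, m) 1 := by
      rcases m with _ | m
      · simp [hrb0]
      · rw [eCp, Nat.add_sub_cancel, smul_add, smul_smul, smul_smul]
        congr 2
        · field_simp
          ring
        · ring
    have hsq (T : Module.End ℂ ((ℕ × ℕ) →₀ ℂ)) (x) : (T ^ 2) x = T (T x) := by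
      rw [sq, Module.End.mul_apply]
    rw [hQC, LinearMap.sub_apply, LinearMap.sub_apply, Module.End.mul_apply, eCm, map_add,
      map_smul, map_smul, mul_smul, mul_smul, lowA, lowB, LinearMap.smul_apply,
      LinearMap.smul_apply, hsq, hsq]
    simp only [Module.End.mul_apply, ekA, ekB, ekAinv, ekBinv, map_smul, smul_smul, smul_add]
    rw [ediag, inv_pow, mul_inv (q ^ m) wb]
    module
  have hU (n : ℕ) : q ^ n * q * (q⁻¹) ^ 0 * wa * wb⁻¹ * ra (n + 1) * rb 0 = 0 := by
    rw [hrb0, mul_zero]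
  have hL (m : ℕ) : q ^ 0 * q⁻¹ * (q⁻¹) ^ m * wa * wb⁻¹ * ra 0 * rb (m + 1) = 0 := by
    rw [hra0, mul_zero, zero_mul]
  rw [hv, tridiagonal_apply_sum QC D
    (fun n m => q ^ n * q⁻¹ * (q⁻¹) ^ m * wa * wb⁻¹ * ra n * rb (m + 1))
    (fun n m => q ^ n * q * (q⁻¹) ^ m * wa * wb⁻¹ * ra (n + 1) * rb m) hL hU eQC,
    Finset.smul_sum]
  simp only [smul_smul]
  rw [sum_smul_single_antidiagonal_inj, forall₂_congr fun n hn => ?_]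
  rw [eq_comm]
  obtain ⟨m, rfl⟩ := Nat.exists_eq_add_of_le hn
  rw [Nat.add_sub_cancel_left]
  have up : q ^ (n - 1) * q * (q⁻¹) ^ (m + 1) * wa * wb⁻¹ * ra (n - 1 + 1) * rb (m + 1)
        * (if n = 0 then 0 else c (n - 1))
      = q ^ (2 * n) * (q⁻¹) ^ (n + m + 1) * wa * wb⁻¹ * ra n * rb (m + 1)
        * (if n = 0 then 0 else c (n - 1)) := by
    rcases n with _ | n
    · simp
    · simp only [Nat.add_sub_cancel, inv_pow]
      field_simp
      ring
  have low : q ^ (n + 1) * q⁻¹ * (q⁻¹) ^ (m - 1) * wa * wb⁻¹ * ra (n + 1) * rb (m - 1 + 1)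
        * (if n = n + m then 0 else c (n + 1))
      = q ^ (2 * n + 1) * (q⁻¹) ^ (n + m) * wa * wb⁻¹ * ra (n + 1) * rb m
        * (if n = n + m then 0 else c (n + 1)) := by
    rcases m with _ | m
    · simp
    · simp only [Nat.add_sub_cancel, inv_pow]
      field_simp
      ring
  rw [up, low]
end
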